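/- Let n ≥ 1, 0 < p < 1 and 0 < q, θ < ∞. Let u, w be weights on (0,∞) and v a weight on ℝⁿ. Define ṽ(t) := (∫_{S^{n-1}} v(t s')^{1/(1-p)} dσ(s'))^{1-p} · t^{(n-1)(1-p)}. Suppose the one-dimensional inequality (∫₀^∞ (∫₀^t g(s)^p ṽ(s) ds)^{q/p} u(t) dt)^{1/q} ≤ C' (∫₀^∞ (∫₀^t g(s) ds)^θ w(t) dt)^{1/θ} holds with constant C' for every nonnegative measurable g on (0,∞). Then for every nonnegative measurable f on ℝⁿ, (∫₀^∞ (∫_{B(0,t)} f(s)^p v(s) ds)^{q/p} u(t) dt)^{1/q} ≤ C' (∫₀^∞ (∫_{B(0,t)} f(s) ds)^θ w(t) dt)^{1/θ}. -/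

import Mathlib

open MeasureTheory Set ENNReal

noncomputable section

/-- The set `B(a,b) = {y ∈ ℝⁿ : a < |y| < b}`. -/
def annulus (n : ℕ) (a b : ℝ) : Set (EuclideanSpace ℝ (Fin n)) :=
  {y | a < ‖y‖ ∧ ‖y‖ < b}

theorem polar_finite (n : ℕ)
    (σ : Measure (Metric.sphere (0 : EuclideanSpace ℝ (Fin n)) 1))
    (hσ : ∀ f : EuclideanSpace ℝ (Fin n) → ℝ≥0∞, Measurable f →
      (∫⁻ x, f x) = ∫⁻ τ in Ioi (0 : ℝ),
        ∫⁻ s', f (τ • (s' : EuclideanSpace ℝ (Fin n))) * ENNReal.ofReal (τ ^ (n - 1)) ∂σ) :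
    IsFiniteMeasure σ := by
  refine ⟨lt_top_iff_ne_top.2 fun htop => ?_⟩
  have h := hσ ((Metric.ball 0 1).indicator 1)
    (measurable_one.indicator Metric.isOpen_ball.measurableSet)
  rw [lintegral_indicator_one Metric.isOpen_ball.measurableSet] at h
  have h1 : (∫⁻ τ in Ioo (0 : ℝ) 1, (⊤ : ℝ≥0∞)) ≤ ∫⁻ τ in Ioi (0 : ℝ),
        ∫⁻ s' : Metric.sphere (0 : EuclideanSpace ℝ (Fin n)) 1, 
          (Metric.ball (0 : EuclideanSpace ℝ (Fin n)) 1).indicator 1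
          (τ • (s' : EuclideanSpace ℝ (Fin n))) * ENNReal.ofReal (τ ^ (n - 1)) ∂σ := by
    refine le_trans ?_ (lintegral_mono_set (show Ioo (0 : ℝ) 1 ⊆ Ioi 0 from Ioo_subset_Ioi_self))
    refine setLIntegral_mono' measurableSet_Ioo fun τ hτ => ?_
    have : ∀ s' : Metric.sphere (0 : EuclideanSpace ℝ (Fin n)) 1,
        (Metric.ball (0 : EuclideanSpace ℝ (Fin n)) 1).indicator (1 : EuclideanSpace ℝ (Fin n) → ℝ≥0∞)
          (τ • (s' : EuclideanSpace ℝ (Fin n))) * ENNReal.ofReal (τ ^ (n - 1))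
          = ENNReal.ofReal (τ ^ (n - 1)) := by
      intro s'
      rw [indicator_of_mem]
      · simp
      · simp [norm_smul, abs_of_pos hτ.1, hτ.2]
    simp_rw [this]
    rw [lintegral_const, htop, ENNReal.mul_top]
    have := pow_pos hτ.1 (n - 1)
    simpa using this
  rw [← h] at h1
  have h2 : volume (Metric.ball (0 : EuclideanSpace ℝ (Fin n)) 1) < ⊤ := measure_ball_lt_top
  simp at h1
  exact h2.ne h1

theorem polar_annulus (n : ℕ)
    (σ : Measure (Metric.sphere (0 : EuclideanSpace ℝ (Fin n)) 1))
    (hσ : ∀ f : EuclideanSpace ℝ (Fin n) → ℝ≥0∞, Measurable f →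
      (∫⁻ x, f x) = ∫⁻ τ in Ioi (0 : ℝ),
        ∫⁻ s', f (τ • (s' : EuclideanSpace ℝ (Fin n))) * ENNReal.ofReal (τ ^ (n - 1)) ∂σ)
    (f : EuclideanSpace ℝ (Fin n) → ℝ≥0∞) (hf : Measurable f) (t : ℝ) :
    ∫⁻ x in annulus n 0 t, f x = ∫⁻ τ in Ioo (0 : ℝ) t,
        ∫⁻ s', f (τ • (s' : EuclideanSpace ℝ (Fin n))) * ENNReal.ofReal (τ ^ (n - 1)) ∂σ := by
  have hA : MeasurableSet (annulus n 0 t) :=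
    (measurableSet_lt measurable_const measurable_norm).inter
      (measurableSet_lt measurable_norm measurable_const)
  rw [← lintegral_indicator hA, hσ _ (hf.indicator hA),
    ← lintegral_indicator measurableSet_Ioi, ← lintegral_indicator measurableSet_Ioo]
  congr 1
  ext τ
  by_cases h0 : 0 < τ
  · rw [indicator_of_mem (show τ ∈ Ioi 0 from h0)]
    by_cases ht : τ < t
    · rw [indicator_of_mem (show τ ∈ Ioo 0 t from ⟨h0, ht⟩)]
      congr 1
      ext s'
      rw [indicator_of_mem]
      have hs : ‖(s' : EuclideanSpace ℝ (Fin n))‖ = 1 := norm_eq_of_mem_sphere s'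
      simp only [annulus, mem_setOf_eq, norm_smul, hs, Real.norm_eq_abs, abs_of_pos h0, mul_one]
      exact ⟨h0, ht⟩
    · rw [indicator_of_notMem (show τ ∉ Ioo 0 t from fun h => ht h.2)]
      rw [← lintegral_zero (μ := σ)]
      congr 1
      ext s'
      rw [indicator_of_notMem, zero_mul]
      simp [annulus, norm_smul, abs_of_pos h0, h0.ne', not_lt.1 ht]
  · rw [indicator_of_notMem (show τ ∉ Ioi 0 from h0),
      indicator_of_notMem (show τ ∉ Ioo 0 t from fun h => h0 h.1)]

theorem statement2 (n : ℕ) (hn : 1 ≤ n) (p q θ : ℝ)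
    (hp0 : 0 < p) (hp1 : p < 1) (hq : 0 < q) (hθ : 0 < θ)
    (u w : ℝ → ℝ≥0∞) (v : EuclideanSpace ℝ (Fin n) → ℝ≥0∞)
    (hum : Measurable u)
    (hu : ∀ᵐ t ∂(volume.restrict (Ioi (0 : ℝ))), 0 < u t ∧ u t < ⊤)
    (hwm : Measurable w)
    (hw : ∀ᵐ t ∂(volume.restrict (Ioi (0 : ℝ))), 0 < w t ∧ w t < ⊤)
    (hvm : Measurable v)
    (hv : ∀ᵐ x ∂(volume : Measure (EuclideanSpace ℝ (Fin n))), 0 < v x ∧ v x < ⊤)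
    (σ : Measure (Metric.sphere (0 : EuclideanSpace ℝ (Fin n)) 1))
    (hσ : ∀ f : EuclideanSpace ℝ (Fin n) → ℝ≥0∞, Measurable f →
      (∫⁻ x, f x) = ∫⁻ τ in Ioi (0 : ℝ),
        ∫⁻ s', f (τ • (s' : EuclideanSpace ℝ (Fin n))) * ENNReal.ofReal (τ ^ (n - 1)) ∂σ)
    (C' : ℝ≥0∞)
    (hC' : ∀ g : ℝ → ℝ≥0∞, Measurable g →
      (∫⁻ t in Ioi (0 : ℝ), (∫⁻ s in Ioo (0 : ℝ) t, g s ^ p *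
          ((∫⁻ s', v (s • (s' : EuclideanSpace ℝ (Fin n))) ^ (1 / (1 - p)) ∂σ) ^ (1 - p) *
            ENNReal.ofReal s ^ (((n : ℝ) - 1) * (1 - p)))) ^ (q / p) * u t) ^ (1 / q) ≤
        C' * (∫⁻ t in Ioi (0 : ℝ), (∫⁻ s in Ioo (0 : ℝ) t, g s) ^ θ * w t) ^ (1 / θ)) :
    ∀ f : EuclideanSpace ℝ (Fin n) → ℝ≥0∞, Measurable f →
      (∫⁻ t in Ioi (0 : ℝ), (∫⁻ s in annulus n 0 t, f s ^ p * v s) ^ (q / p) * u t) ^ (1 / q) ≤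
        C' * (∫⁻ t in Ioi (0 : ℝ), (∫⁻ s in annulus n 0 t, f s) ^ θ * w t) ^ (1 / θ) := by
  intro f hf
  have hfin := polar_finite n σ hσ
  have hjm : Measurable (fun z : ℝ × Metric.sphere (0 : EuclideanSpace ℝ (Fin n)) 1 =>
      z.1 • (z.2 : EuclideanSpace ℝ (Fin n))) := by fun_prop
  set g : ℝ → ℝ≥0∞ := fun τ =>
    ∫⁻ s', f (τ • (s' : EuclideanSpace ℝ (Fin n))) * ENNReal.ofReal (τ ^ (n - 1)) ∂σ with hg
  have hgm : Measurable g := by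
    refine Measurable.lintegral_prod_right' (f := fun z : ℝ × Metric.sphere
      (0 : EuclideanSpace ℝ (Fin n)) 1 => f (z.1 • (z.2 : EuclideanSpace ℝ (Fin n))) *
        ENNReal.ofReal (z.1 ^ (n - 1))) ?_
    exact (hf.comp hjm).mul (by fun_prop)
  have key := hC' g hgm
  have hr : ∀ t, ∫⁻ s in annulus n 0 t, f s = ∫⁻ s in Ioo (0 : ℝ) t, g s :=
    fun t => polar_annulus n σ hσ f hf t
  simp_rw [hr]
  refine le_trans ?_ key
  refine ENNReal.rpow_le_rpow ?_ (by positivity)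
  refine lintegral_mono fun t => ?_
  dsimp only
  gcongr
  rw [polar_annulus n σ hσ (fun s => f s ^ p * v s) (by fun_prop)]
  refine setLIntegral_mono' measurableSet_Ioo fun τ hτ => ?_
  have h1p : 0 < 1 - p := by linarith
  have hτm : Measurable (fun s' : Metric.sphere (0 : EuclideanSpace ℝ (Fin n)) 1 =>
      τ • (s' : EuclideanSpace ℝ (Fin n))) := by fun_prop
  have hft := hf.comp hτm
  have hvt := hvm.comp hτm
  have hconj : Real.HolderConjugate (1 / p) (1 / (1 - p)) := by
    rw [Real.holderConjugate_iff]
    refine ⟨by rw [lt_div_iff₀ hp0]; linarith, by simp⟩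
  have hol := ENNReal.lintegral_mul_le_Lp_mul_Lq σ hconj
    (f := fun s' => f (τ • (s' : EuclideanSpace ℝ (Fin n))) ^ p)
    (g := fun s' => v (τ • (s' : EuclideanSpace ℝ (Fin n))))
    (hft.pow_const p).aemeasurable hvt.aemeasurable
  have hpp : p * (1 / p) = 1 := by field_simp
  simp only [← ENNReal.rpow_mul, hpp, ENNReal.rpow_one, one_div_one_div, Pi.mul_apply] at hol
  have hg' : g τ = (∫⁻ s', f (τ • (s' : EuclideanSpace ℝ (Fin n))) ∂σ) *
      ENNReal.ofReal (τ ^ (n - 1)) := lintegral_mul_const _ hft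
  have e1 : ENNReal.ofReal (τ ^ (n - 1)) = ENNReal.ofReal τ ^ ((n : ℝ) - 1) := by
    rw [ENNReal.ofReal_pow hτ.1.le, ← ENNReal.rpow_natCast, Nat.cast_sub hn, Nat.cast_one]
  have ht0 : ENNReal.ofReal τ ≠ 0 := by simpa using hτ.1
  have e2 : ENNReal.ofReal (τ ^ (n - 1)) = ENNReal.ofReal (τ ^ (n - 1)) ^ p *
      ENNReal.ofReal τ ^ (((n : ℝ) - 1) * (1 - p)) := by
    rw [e1, ← ENNReal.rpow_mul, ← ENNReal.rpow_add _ _ ht0 ENNReal.ofReal_ne_top]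
    congr 1
    ring
  have hm2 : Measurable (fun s' : Metric.sphere (0 : EuclideanSpace ℝ (Fin n)) 1 =>
      f (τ • (s' : EuclideanSpace ℝ (Fin n))) ^ p * v (τ • (s' : EuclideanSpace ℝ (Fin n)))) :=
    (hft.pow_const p).mul hvt
  rw [lintegral_mul_const _ hm2, hg',
    ENNReal.mul_rpow_of_nonneg _ _ hp0.le]
  refine (mul_le_mul_left hol _).trans (le_of_eq ?_)
  nth_rewrite 1 [e2]
  ring
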